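/- Let (C, μ) be a flat-foldable MV pattern, let F be a forcing set of (C, μ), and let (c_j, c_{j+1}) be an adjacent pair of creases within a crimpable sequence of C with μ(c_j) ≠ μ(c_{j+1}). Then F contains c_j or c_{j+1}. -/

import Mathlib

/-- Mountain or valley label for a crease. -/
inductive MV : Type
  | M : MV
  | V : MV
deriving DecidableEq

/-- `(c 0, c 1, …, c n)` is a 1D crease pattern: a strictly increasing finite
sequence of reals with `n ≥ 1`.  The points `c 1, …, c (n-1)` are its creases,
`c 0` and `c n` its ends. -/
def IsCreasePattern (n : ℕ) (c : ℕ → ℝ) : Prop :=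
  1 ≤ n ∧ ∀ i j : ℕ, i < j → j ≤ n → c i < c j

/-- The consecutive creases `(c i, …, c (i+k))` form a crimpable sequence with gap `d`. -/
def IsCrimpable (n : ℕ) (c : ℕ → ℝ) (i k : ℕ) (d : ℝ) : Prop :=
  1 ≤ i ∧ 1 ≤ k ∧ i + k ≤ n - 1 ∧
  (∀ m : ℕ, i ≤ m → m < i + k → c (m + 1) - c m = d) ∧
  d < c i - c (i - 1) ∧ d < c (i + k + 1) - c (i + k)

/-- Additive offset of the folded-position map on the `j`-th interval:
on `[c j, c (j+1)]` the folded-position map is `x ↦ (-1)^j * x + foldOffset c j`. -/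
def foldOffset (c : ℕ → ℝ) : ℕ → ℝ
  | 0 => 0
  | j + 1 => foldOffset c (j) + 2 * (-1 : ℝ) ^ j * c (j + 1)

/-- Folded position of a point `x` belonging to the `j`-th interval `[c j, c (j+1)]`.
This is the unique continuous map equal to the identity on `[c 0, c 1]`, isometric on
every interval, and reversing direction at every crease. -/
def foldPos (c : ℕ → ℝ) (j : ℕ) (x : ℝ) : ℝ := (-1 : ℝ) ^ j * x + foldOffset c j

/-- Folded position of the crease `c i`. -/
def foldCrease (c : ℕ → ℝ) (i : ℕ) : ℝ := foldPos c i (c i)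

/-- `x` lies strictly `lt`-between `a` and `b`. -/
def Between (lt : ℕ → ℕ → Prop) (a b x : ℕ) : Prop :=
  (lt a x ∧ lt x b) ∨ (lt b x ∧ lt x a)

/-- The MV pattern `(C, μ)` is flat-foldable: there is a strict linear order `lt`
("strictly below") on the intervals `I_0, …, I_{n-1}` (indexed `0, …, n-1`) such that:
(i) for each crease `i`, `I_{i-1}` is below `I_i` iff either `μ i = V` and the folded map
is increasing on `I_{i-1}` (slope `(-1)^(i-1) = 1`), or `μ i = M` and it is decreasing;
(ii) for each crease `i` and each interval `J` whose folded image contains the folded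
crease position in its interior, `J` is not strictly between `I_{i-1}` and `I_i`;
(iii) for distinct creases `i, j` folding to the same point, it is not the case that
exactly one of `I_{j-1}`, `I_j` is strictly between `I_{i-1}` and `I_i`. -/
def IsFlatFoldable (n : ℕ) (c : ℕ → ℝ) (μ : ℕ → MV) : Prop :=
  ∃ lt : ℕ → ℕ → Prop,
    (∀ j, j < n → ¬ lt j j) ∧
    (∀ a b e, lt a b → lt b e → lt a e) ∧
    (∀ a b, a < n → b < n → a ≠ b → lt a b ∨ lt b a) ∧
    (∀ a b, lt a b → a < n ∧ b < n) ∧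
    (∀ i, 1 ≤ i → i ≤ n - 1 →
      (lt (i - 1) i ↔ ((μ i = MV.V ∧ Even (i - 1)) ∨ (μ i = MV.M ∧ Odd (i - 1))))) ∧
    (∀ i, 1 ≤ i → i ≤ n - 1 → ∀ j, j < n →
      foldCrease c i ∈
        Set.Ioo (min (foldPos c j (c j)) (foldPos c j (c (j + 1))))
                (max (foldPos c j (c j)) (foldPos c j (c (j + 1)))) →
      ¬ Between lt (i - 1) i j) ∧
    (∀ i j, 1 ≤ i → i ≤ n - 1 → 1 ≤ j → j ≤ n - 1 → i ≠ j →
      foldCrease c i = foldCrease c j →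
      (Between lt (i - 1) i (j - 1) ↔ Between lt (i - 1) i j))

/-- `F` is a forcing set for the MV pattern `(C, μ)`: a set of creases such that the only
flat-foldable assignment agreeing with `μ` on `F` is `μ` itself (on all creases). -/
def IsForcingSet (n : ℕ) (c : ℕ → ℝ) (μ : ℕ → MV) (F : Set ℕ) : Prop :=
  F ⊆ Set.Icc 1 (n - 1) ∧
  ∀ ν : ℕ → MV, IsFlatFoldable n c ν → (∀ x ∈ F, ν x = μ x) →
    ∀ x, 1 ≤ x → x ≤ n - 1 → ν x = μ x

/-- The crease pattern produced by a monocrimp at the adjacent pair `(c j, c (j+1))`: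
it deletes `c j` and `c (j+1)` and translates all later points by `-2 * (c (j+1) - c j)`. -/
def monocrimpPattern (c : ℕ → ℝ) (j : ℕ) : ℕ → ℝ :=
  fun x => if x < j then c x else c (x + 2) - 2 * (c (j + 1) - c j)

/-- `z` lies strictly between `x` and `y`, in either orientation. -/
def StrictBtw {α : Type*} [LT α] (x y z : α) : Prop :=
  (x < z ∧ z < y) ∨ (y < z ∧ z < x)

/-- A row of `n` intervals with images `[lo x, hi x]`, where the images of the intervals `m` and
`m + 1` share the endpoint `P m` and lie on the same side of it. -/
structure FoldedRow (n : ℕ) (lo hi P : ℕ → ℝ) : Prop where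
  lo_lt_hi : ∀ x < n, lo x < hi x
  crease : ∀ m, m + 1 < n → (P m = hi m ∧ P m = hi (m + 1)) ∨ (P m = lo m ∧ P m = lo (m + 1))
  crease_ne : ∀ m, m + 2 < n → P m ≠ P (m + 1)

/-- The heights `r` form a layer ordering without self-crossings of the folded row. -/
structure Noncrossing {α : Type*} [LT α] (n : ℕ) (lo hi P : ℕ → ℝ) (r : ℕ → α) : Prop where
  inj : ∀ x < n, ∀ y < n, r x = r y → x = y
  layer : ∀ m, m + 1 < n → ∀ x < n, lo x < P m → P m < hi x →
    ¬ StrictBtw (r m) (r (m + 1)) (r x)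
  pair : ∀ m, m + 1 < n → ∀ m', m' + 1 < n → P m = P m' →
    (StrictBtw (r m) (r (m + 1)) (r m') ↔ StrictBtw (r m) (r (m + 1)) (r (m' + 1)))

open Classical in
/-- The position of the layer `x` when the zigzag `u, u + 1, u + 2` is turned over. -/
noncomputable def zigzagKey {α : Type*} [LT α] (lo hi : ℕ → ℝ) (r : ℕ → α) (u x : ℕ) : ℕ :=
  if x = u then 5 else if x = u + 1 then 4 else if x = u + 2 then 3
  else if r x < r u then 0
  else if r x < r (u + 1) then (if hi x ≤ hi (u + 1) then 6 else 1)
  else if r x < r (u + 2) then (if lo (u + 1) ≤ lo x then 2 else 7)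
  else 8

/-- All layers whose keys lie in a block `[s, t]` are on the same side of a layer whose key is
outside of the block. -/
theorem lexBtw_congr_of_block {α : Type*} [LT α] (s t : ℕ) {a b k k' : ℕ} {x y z z' : α}
    (ha : a < s ∨ t < a) (hb : b < s ∨ t < b) (hk : s ≤ k ∧ k ≤ t) (hk' : s ≤ k' ∧ k' ≤ t) :
    ((a < k ∨ (a = k ∧ x < z)) ∧ (k < b ∨ (k = b ∧ z < y)) ∨
      (b < k ∨ (b = k ∧ y < z)) ∧ (k < a ∨ (k = a ∧ z < x))) ↔
    ((a < k' ∨ (a = k' ∧ x < z')) ∧ (k' < b ∨ (k' = b ∧ z' < y)) ∨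
      (b < k' ∨ (b = k' ∧ y < z')) ∧ (k' < a ∨ (k' = a ∧ z' < x))) := by
  have h1 : a ≠ k := by omega
  have h2 : b ≠ k := by omega
  have h3 : a ≠ k' := by omega
  have h4 : b ≠ k' := by omega
  simp only [h1, h2, h3, h4, h1.symm, h2.symm, h3.symm, h4.symm, false_and, or_false]
  omega

set_option maxHeartbeats 4000000 in
/-- A zigzag whose middle interval is shortest can be turned over without crossings and without
changing the relative height of the two layers at any other crease. -/
theorem exists_noncrossing_reverse_zigzag {α : Type*} [LinearOrder α] {n : ℕ} {lo hi P : ℕ → ℝ}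
    {r : ℕ → α} (hR : FoldedRow n lo hi P) (hr : Noncrossing n lo hi P r) {u : ℕ}
    (hu : u + 2 < n) (h01 : r u < r (u + 1)) (h12 : r (u + 1) < r (u + 2))
    (hP0 : P u = hi (u + 1)) (hP1 : P (u + 1) = lo (u + 1)) (hhi : hi u = hi (u + 1))
    (hlo : lo (u + 2) = lo (u + 1)) (hlo' : lo u ≤ lo (u + 1)) (hhi' : hi (u + 1) ≤ hi (u + 2)) :
    ∃ r' : ℕ → ℕ ×ₗ α, Noncrossing n lo hi P r' ∧
      (∀ m, m + 1 < n → m ≠ u → m ≠ u + 1 → (r' m < r' (m + 1) ↔ r m < r (m + 1))) ∧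
      r' (u + 1) < r' u ∧ r' (u + 2) < r' (u + 1) := by
  obtain ⟨hlt, hcr, hne⟩ := hR
  obtain ⟨hinj, hlay, hpair⟩ := hr
  set K := zigzagKey lo hi r u with hKdef
  have hpq : lo (u + 1) < hi (u + 1) := hlt _ (by omega)
  set p := lo (u + 1) with hp
  set q := hi (u + 1) with hq
  -- layers in the left pocket do not cross `q`, those in the right pocket do not cross `p`
  have hB : ∀ x < n, r u < r x → r x < r (u + 1) → hi x ≤ q ∨ q ≤ lo x := by
    intro x hx h1 h2
    by_contra! h
    exact hlay u (by omega) x hx (by rw [hP0]; exact h.2) (by rw [hP0]; exact h.1) (.inl ⟨h1, h2⟩)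
  have hC : ∀ x < n, r (u + 1) < r x → r x < r (u + 2) → p ≤ lo x ∨ hi x ≤ p := by
    intro x hx h1 h2
    by_contra! h
    exact hlay (u + 1) (by omega) x hx (by rw [hP1]; exact h.1) (by rw [hP1]; exact h.2)
      (.inl ⟨h1, h2⟩)
  have hK : ∀ x < n,
      (K x = 5 ∧ x = u) ∨ (K x = 4 ∧ x = u + 1) ∨ (K x = 3 ∧ x = u + 2) ∨
      (x ≠ u ∧ x ≠ u + 1 ∧ x ≠ u + 2 ∧
        ((K x = 0 ∧ r x < r u) ∨
        (K x = 6 ∧ r u < r x ∧ r x < r (u + 1) ∧ hi x ≤ q) ∨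
        (K x = 1 ∧ r u < r x ∧ r x < r (u + 1) ∧ q ≤ lo x) ∨
        (K x = 2 ∧ r (u + 1) < r x ∧ r x < r (u + 2) ∧ p ≤ lo x) ∨
        (K x = 7 ∧ r (u + 1) < r x ∧ r x < r (u + 2) ∧ hi x ≤ p) ∨
        (K x = 8 ∧ r (u + 2) < r x))) := by
    intro x hx
    have i0 := hinj x hx u (by omega)
    have i1 := hinj x hx (u + 1) (by omega)
    have i2 := hinj x hx (u + 2) (by omega)
    have b := hB x hx
    have c := hC x hx
    simp only [hKdef, zigzagKey, ← hp, ← hq]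
    clear_value p q K
    clear hKdef hlay hpair hcr hne hlt hB hC
    split_ifs <;> grind
  have hr' : ∀ x y, toLex (K x, r x) < toLex (K y, r y) ↔ K x < K y ∨ (K x = K y ∧ r x < r y) :=
    fun x y => Prod.Lex.toLex_lt_toLex
  clear_value K p q
  clear hKdef
  have hu0 := hlt u (by omega)
  have hu2 := hlt (u + 2) (by omega)
  have htouch : ∀ m, m + 1 < n →
      lo m ≤ P m ∧ P m ≤ hi m ∧ lo (m + 1) ≤ P m ∧ P m ≤ hi (m + 1) := by
    intro m hm
    have a := hlt m (by omega)
    have b := hlt (m + 1) hm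
    rcases hcr m hm with h | h <;> refine ⟨?_, ?_, ?_, ?_⟩ <;> linarith
  have keepL : ∀ x < n, ∀ y < n, lo x < p → lo y < p →
      ((K x < K y ∨ (K x = K y ∧ r x < r y)) ↔ r x < r y) := by
    intro x hx y hy h1 h2
    have lx := hlt x hx
    have ly := hlt y hy
    have kx := hK x hx
    have ky := hK y hy
    clear hlay hpair hcr hne hlt hB hC hr' htouch hinj hK
    grind (splits := 40)
  have keepR : ∀ x < n, ∀ y < n, q < hi x → q < hi y →
      ((K x < K y ∨ (K x = K y ∧ r x < r y)) ↔ r x < r y) := by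
    intro x hx y hy h1 h2
    have lx := hlt x hx
    have ly := hlt y hy
    have kx := hK x hx
    have ky := hK y hy
    clear hlay hpair hcr hne hlt hB hC hr' htouch hinj hK keepL
    grind (splits := 40)
  have hmid : ∀ m, m + 1 < n → p < P m → P m < q → K m = K (m + 1) ∧
      (K m = 0 ∨ K m = 2 ∨ K m = 6 ∨ K m = 8) := by
    intro m hm h1 h2
    have kx := hK m (by omega)
    have ky := hK (m + 1) hm
    have t := htouch m hm
    have l0 := hlay m hm u (by omega) (by linarith) (by linarith)
    have l1 := hlay m hm (u + 1) (by omega) (by linarith) (by linarith)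
    have l2 := hlay m hm (u + 2) (by omega) (by linarith) (by linarith)
    have c := hcr m hm
    have lx := hlt m (by omega)
    have ly := hlt (m + 1) hm
    simp only [StrictBtw] at l0 l1 l2
    clear hlay hpair hcr hne hlt hB hC hr' htouch hinj hK keepL keepR
    grind (splits := 40)
  have hatp : ∀ m, m + 1 < n → m ≠ u + 1 → P m = p → (K m = K (m + 1) ∧ (K m = 2 ∨ K m = 7)) ∨
      ((K m = 0 ∨ K m = 5 ∨ K m = 6 ∨ K m = 8) ∧
        (K (m + 1) = 0 ∨ K (m + 1) = 5 ∨ K (m + 1) = 6 ∨ K (m + 1) = 8)) := by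
    intro m hm hmu h1
    have kx := hK m (by omega)
    have ky := hK (m + 1) hm
    have t := htouch m hm
    have l1 := hpair m hm (u + 1) (by omega) (by linarith)
    have l2 := hpair (u + 1) (by omega) m hm (by linarith)
    have c := hcr m hm
    have lx := hlt m (by omega)
    have ly := hlt (m + 1) hm
    have n1 := hne u (by omega)
    have n2 := hne (u + 1)
    simp only [StrictBtw] at l1 l2
    clear hlay hpair hcr hne hlt hB hC hr' htouch hinj hK keepL keepR
    grind (splits := 40)
  have hatq : ∀ m, m + 1 < n → m ≠ u → P m = q → (K m = K (m + 1) ∧ (K m = 1 ∨ K m = 6)) ∨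
      ((K m = 0 ∨ K m = 2 ∨ K m = 3 ∨ K m = 8) ∧
        (K (m + 1) = 0 ∨ K (m + 1) = 2 ∨ K (m + 1) = 3 ∨ K (m + 1) = 8)) := by
    intro m hm hmu h1
    have kx := hK m (by omega)
    have ky := hK (m + 1) hm
    have t := htouch m hm
    have l1 := hpair m hm u (by omega) (by linarith)
    have l2 := hpair u (by omega) m hm (by linarith)
    have c := hcr m hm
    have lx := hlt m (by omega)
    have ly := hlt (m + 1) hm
    have n1 := hne u (by omega)
    have n2 := hne m
    simp only [StrictBtw] at l1 l2
    clear hlay hpair hcr hne hlt hB hC hr' htouch hinj hK keepL keepR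
    grind (splits := 40)
  have hK0 : K u = 5 := by have := hK u (by omega); grind
  have hK1 : K (u + 1) = 4 := by have := hK (u + 1) (by omega); grind
  have hK2 : K (u + 2) = 3 := by have := hK (u + 2) (by omega); grind
  have hK2' : K (u + 1 + 1) = 3 := hK2
  have keepP : ∀ x < n, ∀ y < n, (K x = 0 ∨ 5 ≤ K x) → (K y = 0 ∨ 5 ≤ K y) →
      ((K x < K y ∨ (K x = K y ∧ r x < r y)) ↔ r x < r y) := by
    intro x hx y hy h1 h2
    have kx := hK x hx
    have ky := hK y hy
    clear hlay hpair hcr hne hlt hB hC hr' htouch hinj hK keepL keepR hmid hatp hatq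
    grind (splits := 40)
  have keepQ : ∀ x < n, ∀ y < n, (K x ≤ 3 ∨ K x = 8) → (K y ≤ 3 ∨ K y = 8) →
      ((K x < K y ∨ (K x = K y ∧ r x < r y)) ↔ r x < r y) := by
    intro x hx y hy h1 h2
    have kx := hK x hx
    have ky := hK y hy
    clear hlay hpair hcr hne hlt hB hC hr' htouch hinj hK keepL keepR hmid hatp hatq keepP
    grind (splits := 40)
  have crossP : ∀ x < n, lo x < p → p < hi x → K x = 0 ∨ K x = 5 ∨ K x = 6 ∨ K x = 8 := by
    intro x hx h1 h2
    have kx := hK x hx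
    clear hlay hpair hcr hne hlt hB hC hr' htouch hinj hK keepL keepR hmid hatp hatq keepP keepQ
    grind (splits := 40)
  have crossQ : ∀ x < n, lo x < q → q < hi x → K x = 0 ∨ K x = 2 ∨ K x = 3 ∨ K x = 8 := by
    intro x hx h1 h2
    have kx := hK x hx
    clear hlay hpair hcr hne hlt hB hC hr' htouch hinj hK keepL keepR hmid hatp hatq keepP keepQ
    grind (splits := 40)
  refine ⟨fun x => toLex (K x, r x), ⟨?_, ?_, ?_⟩, ?_, ?_, ?_⟩
  · intro x hx y hy h
    exact hinj x hx y hy (congrArg (fun z => (ofLex z).2) h)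
  · intro m hm x hx h1 h2
    have hl := hlay m hm x hx h1 h2
    have hm0 : m < n := by omega
    have t := htouch m hm
    simp only [StrictBtw, hr'] at hl ⊢
    by_cases hL : P m < p
    · rwa [keepL m hm0 x hx, keepL x hx m hm0, keepL x hx (m + 1) hm, keepL (m + 1) hm x hx] <;>
        linarith
    by_cases hRt : q < P m
    · rwa [keepR m hm0 x hx, keepR x hx m hm0, keepR x hx (m + 1) hm, keepR (m + 1) hm x hx] <;>
        linarith
    have ox : P m = p ∨ P m = q ∨ (p < P m ∧ P m < q) := by grind
    rcases ox with ox | ox | ox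
    · have kx := crossP x hx (ox ▸ h1) (ox ▸ h2)
      by_cases hmu : m = u + 1
      · rw [hmu]
        omega
      rcases hatp m hm hmu ox with c | c
      · omega
      · rwa [keepP m hm0 x hx, keepP x hx m hm0, keepP x hx (m + 1) hm, keepP (m + 1) hm x hx] <;>
          omega
    · have kx := crossQ x hx (ox ▸ h1) (ox ▸ h2)
      by_cases hmu : m = u
      · rw [hmu]
        omega
      rcases hatq m hm hmu ox with c | c
      · omega
      · rwa [keepQ m hm0 x hx, keepQ x hx m hm0, keepQ x hx (m + 1) hm, keepQ (m + 1) hm x hx] <;>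
          omega
    · have c := hmid m hm ox.1 ox.2
      rw [← c.1]
      clear hlay hpair hcr hne hlt hB hC hr' htouch hinj hK keepL keepR keepP keepQ
      grind
  · intro m hm m' hm' hPP
    have hl := hpair m hm m' hm' hPP
    have hm0 : m < n := by omega
    have hm0' : m' < n := by omega
    have t := htouch m hm
    have t' := htouch m' hm'
    simp only [StrictBtw, hr'] at hl ⊢
    by_cases hL : P m < p
    · rwa [keepL m hm0 m' hm0', keepL m' hm0' m hm0, keepL m' hm0' (m + 1) hm,
        keepL (m + 1) hm m' hm0', keepL m hm0 (m' + 1) hm', keepL (m' + 1) hm' m hm0,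
        keepL (m' + 1) hm' (m + 1) hm, keepL (m + 1) hm (m' + 1) hm'] <;> linarith
    by_cases hRt : q < P m
    · rwa [keepR m hm0 m' hm0', keepR m' hm0' m hm0, keepR m' hm0' (m + 1) hm,
        keepR (m + 1) hm m' hm0', keepR m hm0 (m' + 1) hm', keepR (m' + 1) hm' m hm0,
        keepR (m' + 1) hm' (m + 1) hm, keepR (m + 1) hm (m' + 1) hm'] <;> linarith
    have ox : P m = p ∨ P m = q ∨ (p < P m ∧ P m < q) := by grind
    rcases ox with ox | ox | ox
    · have hcls : ∀ l, l + 1 < n → P l = p → l = u + 1 ∨ (K l = 2 ∧ K (l + 1) = 2) ∨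
          ((K l = 0 ∨ 5 ≤ K l) ∧ (K (l + 1) = 0 ∨ 5 ≤ K (l + 1))) := by
        intro l hl hl'
        by_cases h : l = u + 1
        · exact .inl h
        · have := hatp l hl h hl'
          omega
      rcases hcls m hm ox with c | c | c
      · rcases hcls m' hm' (hPP ▸ ox) with d | d | d
        · simp [c, d]
        all_goals
          subst c
          refine iff_of_false ?_ ?_ <;>
            rintro (⟨h | h, h' | h'⟩ | ⟨h | h, h' | h'⟩) <;> omega
      · rcases hcls m' hm' (hPP ▸ ox) with d | d | d
        · subst d
          refine iff_of_false ?_ ?_ <;>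
            rintro (⟨h | h, h' | h'⟩ | ⟨h | h, h' | h'⟩) <;> omega
        · simpa [c.1, c.2, d.1, d.2] using hl
        · refine iff_of_false ?_ ?_ <;>
            rintro (⟨h | h, h' | h'⟩ | ⟨h | h, h' | h'⟩) <;> omega
      · rcases hcls m' hm' (hPP ▸ ox) with d | d | d
        · exact lexBtw_congr_of_block 2 4 (by omega) (by omega) (by subst d; omega)
            (by subst d; omega)
        · exact lexBtw_congr_of_block 2 4 (by omega) (by omega) (by omega) (by omega)
        · rwa [keepP m hm0 m' hm0', keepP m' hm0' m hm0, keepP m' hm0' (m + 1) hm,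
            keepP (m + 1) hm m' hm0', keepP m hm0 (m' + 1) hm', keepP (m' + 1) hm' m hm0,
            keepP (m' + 1) hm' (m + 1) hm, keepP (m + 1) hm (m' + 1) hm'] <;> omega
    · have hcls : ∀ l, l + 1 < n → P l = q → l = u ∨ (K l = 6 ∧ K (l + 1) = 6) ∨
          ((K l ≤ 3 ∨ K l = 8) ∧ (K (l + 1) ≤ 3 ∨ K (l + 1) = 8)) := by
        intro l hl hl'
        by_cases h : l = u
        · exact .inl h
        · have := hatq l hl h hl'
          omega
      rcases hcls m hm ox with c | c | c
      · rcases hcls m' hm' (hPP ▸ ox) with d | d | d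
        · simp [c, d]
        all_goals
          subst c
          refine iff_of_false ?_ ?_ <;>
            rintro (⟨h | h, h' | h'⟩ | ⟨h | h, h' | h'⟩) <;> omega
      · rcases hcls m' hm' (hPP ▸ ox) with d | d | d
        · subst d
          refine iff_of_false ?_ ?_ <;>
            rintro (⟨h | h, h' | h'⟩ | ⟨h | h, h' | h'⟩) <;> omega
        · simpa [c.1, c.2, d.1, d.2] using hl
        · refine iff_of_false ?_ ?_ <;>
            rintro (⟨h | h, h' | h'⟩ | ⟨h | h, h' | h'⟩) <;> omega
      · rcases hcls m' hm' (hPP ▸ ox) with d | d | d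
        · exact lexBtw_congr_of_block 4 6 (by omega) (by omega) (by subst d; omega)
            (by subst d; omega)
        · exact lexBtw_congr_of_block 4 6 (by omega) (by omega) (by omega) (by omega)
        · rwa [keepQ m hm0 m' hm0', keepQ m' hm0' m hm0, keepQ m' hm0' (m + 1) hm,
            keepQ (m + 1) hm m' hm0', keepQ m hm0 (m' + 1) hm', keepQ (m' + 1) hm' m hm0,
            keepQ (m' + 1) hm' (m + 1) hm, keepQ (m + 1) hm (m' + 1) hm'] <;> omega
    · have c := hmid m hm ox.1 ox.2
      have d := hmid m' hm' (hPP ▸ ox.1) (hPP ▸ ox.2)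
      by_cases h : K m = K m'
      · simpa [← c.1, ← d.1, h] using hl
      · refine iff_of_false ?_ ?_ <;>
          rintro (⟨h | h, h' | h'⟩ | ⟨h | h, h' | h'⟩) <;> omega
  · intro m hm h1 h2
    have hm0 : m < n := by omega
    have t := htouch m hm
    simp only [hr']
    by_cases hL : P m < p
    · exact keepL m hm0 (m + 1) hm (by linarith) (by linarith)
    by_cases hRt : q < P m
    · exact keepR m hm0 (m + 1) hm (by linarith) (by linarith)
    have ox : P m = p ∨ P m = q ∨ (p < P m ∧ P m < q) := by grind
    rcases ox with ox | ox | ox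
    · rcases hatp m hm h2 ox with c | c
      · simp [c.1]
      · exact keepP m hm0 (m + 1) hm (by omega) (by omega)
    · rcases hatq m hm h1 ox with c | c
      · simp [c.1]
      · exact keepQ m hm0 (m + 1) hm (by omega) (by omega)
    · simp [(hmid m hm ox.1 ox.2).1]
  · simp only [hr']
    omega
  · simp only [hr']
    omega

theorem strictBtw_toDual {α : Type*} [LT α] (x y z : α) :
    StrictBtw (OrderDual.toDual x) (OrderDual.toDual y) (OrderDual.toDual z) ↔
      StrictBtw x y z := by
  simp only [StrictBtw, OrderDual.toDual_lt_toDual]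
  tauto

/-- Turning the whole folded state upside down preserves noncrossing. -/
theorem Noncrossing.toDual {α : Type*} [LT α] {n : ℕ} {lo hi P : ℕ → ℝ} {r : ℕ → α}
    (h : Noncrossing n lo hi P r) :
    Noncrossing n lo hi P (fun x => OrderDual.toDual (r x)) where
  inj x hx y hy e := h.inj x hx y hy (OrderDual.toDual.injective e)
  layer m hm x hx h1 h2 := by
    simpa only [strictBtw_toDual] using h.layer m hm x hx h1 h2
  pair m hm m' hm' e := by
    simpa only [strictBtw_toDual] using h.pair m hm m' hm' e

/-- Noncrossing for the folded path that visits the positions `f 0, f 1, …, f n`. -/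
abbrev PathNoncrossing {α : Type*} [LT α] (n : ℕ) (f : ℕ → ℝ) (r : ℕ → α) : Prop :=
  Noncrossing n (fun x => min (f x) (f (x + 1))) (fun x => max (f x) (f (x + 1)))
    (fun x => f (x + 1)) r

/-- Reflecting the folded state preserves noncrossing. -/
theorem pathNoncrossing_neg {α : Type*} [LT α] {n : ℕ} {f : ℕ → ℝ} {r : ℕ → α}
    (h : PathNoncrossing n f r) : PathNoncrossing n (fun x => -f x) r where
  inj := h.inj
  layer m hm x hx h1 h2 := by
    refine h.layer m hm x hx ?_ ?_
    · simp only [max_neg_neg, neg_lt_neg_iff] at h2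
      exact h2
    · simp only [min_neg_neg, neg_lt_neg_iff] at h1
      exact h1
  pair m hm m' hm' e := h.pair m hm m' hm' (neg_injective e)

theorem foldedRow_of_alternating {n : ℕ} {f : ℕ → ℝ} (hne : ∀ m < n, f m ≠ f (m + 1))
    (halt : ∀ m, m + 1 < n → (f m < f (m + 1) ↔ f (m + 2) < f (m + 1))) :
    FoldedRow n (fun x => min (f x) (f (x + 1))) (fun x => max (f x) (f (x + 1)))
      (fun x => f (x + 1)) where
  lo_lt_hi x hx := min_lt_max.2 (hne x hx)
  crease m hm := by
    have h0 := hne m (by omega)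
    have h1 := hne (m + 1) hm
    have h := halt m hm
    simp only [add_assoc, Nat.reduceAdd] at *
    rcases lt_or_gt_of_ne h0 with h0 | h0
    · exact .inl ⟨(max_eq_right h0.le).symm, (max_eq_left (h.1 h0).le).symm⟩
    · have h2 : f (m + 1) ≤ f (m + 2) := not_lt.1 fun h2 => (h.2 h2).asymm h0
      exact .inr ⟨(min_eq_right h0.le).symm, (min_eq_left h2).symm⟩
  crease_ne m hm := hne (m + 1) (by omega)

/-- The version of `exists_noncrossing_reverse_zigzag` for a folded path and an ascending zigzag. -/
theorem exists_pathNoncrossing_reverse_ascending {α : Type} [LinearOrder α] {n : ℕ} {f : ℕ → ℝ}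
    {r : ℕ → α} (hne : ∀ m < n, f m ≠ f (m + 1))
    (halt : ∀ m, m + 1 < n → (f m < f (m + 1) ↔ f (m + 2) < f (m + 1)))
    (hr : PathNoncrossing n f r) {u : ℕ} (hu : u + 2 < n)
    (h01 : r u < r (u + 1)) (h12 : r (u + 1) < r (u + 2))
    (hl : |f (u + 2) - f (u + 1)| ≤ |f (u + 1) - f u|)
    (hl' : |f (u + 2) - f (u + 1)| ≤ |f (u + 3) - f (u + 2)|) :
    ∃ r' : ℕ → ℕ ×ₗ α, PathNoncrossing n f r' ∧
      (∀ m, m + 1 < n → m ≠ u → m ≠ u + 1 → (r' m < r' (m + 1) ↔ r m < r (m + 1))) ∧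
      r' (u + 1) < r' u ∧ r' (u + 2) < r' (u + 1) := by
  wlog hup : f u < f (u + 1) generalizing f
  · have hup' : f (u + 1) < f u := lt_of_le_of_ne (not_lt.1 hup) (hne u (by omega)).symm
    obtain ⟨r', h, h'⟩ := this (f := fun x => -f x) (fun m hm => by simpa using hne m hm)
      (fun m hm => by
        have h0 := hne m (by omega)
        have h1 := hne (m + 1) hm
        have h := halt m hm
        simp only [neg_lt_neg_iff]
        grind)
      (pathNoncrossing_neg hr)
      (by simpa only [neg_sub_neg, abs_sub_comm] using hl)
      (by simpa only [neg_sub_neg, abs_sub_comm] using hl')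
      (by simpa using hup')
    exact ⟨r', by simpa using pathNoncrossing_neg h, h'⟩
  have h1 := (halt u (by omega)).1 hup
  have h2 : f (u + 2) < f (u + 3) :=
    lt_of_le_of_ne (not_lt.1 fun h => h1.asymm ((halt (u + 1) hu).2 h)) (hne (u + 2) hu)
  rw [abs_of_neg (by linarith), abs_of_pos (by linarith)] at hl hl'
  have e0 : max (f u) (f (u + 1)) = f (u + 1) := max_eq_right hup.le
  have e1 : max (f (u + 1)) (f (u + 1 + 1)) = f (u + 1) := max_eq_left h1.le
  have e2 : max (f (u + 2)) (f (u + 2 + 1)) = f (u + 3) := max_eq_right h2.le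
  have i0 : min (f u) (f (u + 1)) = f u := min_eq_left hup.le
  have i1 : min (f (u + 1)) (f (u + 1 + 1)) = f (u + 2) := min_eq_right h1.le
  have i2 : min (f (u + 2)) (f (u + 2 + 1)) = f (u + 2) := min_eq_left h2.le
  exact exists_noncrossing_reverse_zigzag (foldedRow_of_alternating hne halt) hr hu h01 h12
    e1.symm i1.symm (e0.trans e1.symm) (i2.trans i1.symm) (by rw [i0, i1]; linarith)
    (by rw [e1, e2]; linarith)

/-- A zigzag of a folded path whose middle interval is shortest can be turned over, which changes
the relative height of adjacent layers exactly at its two creases. -/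
theorem exists_pathNoncrossing_reverse_zigzag {α : Type} [LinearOrder α] {n : ℕ} {f : ℕ → ℝ}
    {r : ℕ → α} (hne : ∀ m < n, f m ≠ f (m + 1))
    (halt : ∀ m, m + 1 < n → (f m < f (m + 1) ↔ f (m + 2) < f (m + 1)))
    (hr : PathNoncrossing n f r) {u : ℕ} (hu : u + 2 < n)
    (hz : r u < r (u + 1) ↔ r (u + 1) < r (u + 2))
    (hl : |f (u + 2) - f (u + 1)| ≤ |f (u + 1) - f u|)
    (hl' : |f (u + 2) - f (u + 1)| ≤ |f (u + 3) - f (u + 2)|) :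
    ∃ (β : Type) (_ : LinearOrder β) (r' : ℕ → β), PathNoncrossing n f r' ∧
      (∀ m, m + 1 < n → m ≠ u → m ≠ u + 1 → (r' m < r' (m + 1) ↔ r m < r (m + 1))) ∧
      (r' u < r' (u + 1) ↔ ¬ r u < r (u + 1)) ∧
      (r' (u + 1) < r' (u + 2) ↔ ¬ r (u + 1) < r (u + 2)) := by
  have hlt_or : ∀ m, m + 1 < n → r m < r (m + 1) ∨ r (m + 1) < r m := fun m hm =>
    lt_or_gt_of_ne fun h => by
      have := hr.inj m (by omega) (m + 1) hm h
      omega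
  by_cases h01 : r u < r (u + 1)
  · obtain ⟨r', h, h1, h2, h3⟩ :=
      exists_pathNoncrossing_reverse_ascending hne halt hr hu h01 (hz.1 h01) hl hl'
    exact ⟨_, inferInstance, r', h, h1, iff_of_false h2.asymm (not_not.2 h01),
      iff_of_false h3.asymm (not_not.2 (hz.1 h01))⟩
  · have h10 := (hlt_or u (by omega)).resolve_left h01
    have h12 : ¬ r (u + 1) < r (u + 2) := fun h => h01 (hz.2 h)
    have h21 := (hlt_or (u + 1) hu).resolve_left h12
    obtain ⟨r', h, h1, h2, h3⟩ :=
      exists_pathNoncrossing_reverse_ascending hne halt hr.toDual hu h10 h21 hl hl'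
    refine ⟨_, inferInstance, fun x => OrderDual.toDual (r' x), h.toDual, fun m hm hm0 hm1 => ?_,
      iff_of_true h2 h01, iff_of_true h3 h12⟩
    have h4 := h1 m hm hm0 hm1
    have h5 := hlt_or m hm
    have h6 : r' m < r' (m + 1) ∨ r' (m + 1) < r' m := lt_or_gt_of_ne fun e => by
      have := h.inj m (by omega) (m + 1) hm e
      omega
    simp only [OrderDual.toDual_lt_toDual] at h4 ⊢
    constructor
    · intro h7
      exact h5.resolve_right fun h8 => (h4.2 h8).asymm h7
    · intro h7
      exact h6.resolve_left fun h8 => (h4.1 h8).asymm h7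

/-- A strict linear order on `0, …, n - 1` is induced by a height function. -/
theorem exists_height {n : ℕ} {lt : ℕ → ℕ → Prop} (hirr : ∀ j, j < n → ¬ lt j j)
    (htr : ∀ a b e, lt a b → lt b e → lt a e)
    (htot : ∀ a b, a < n → b < n → a ≠ b → lt a b ∨ lt b a)
    (hdom : ∀ a b, lt a b → a < n ∧ b < n) :
    ∃ r : ℕ → ℕ, ∀ a < n, ∀ b < n, (r a < r b ↔ lt a b) := by
  classical
  have key : ∀ a b, lt a b →
      ((Finset.range n).filter (lt · a)).card < ((Finset.range n).filter (lt · b)).card := by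
    intro a b h
    have ha := (hdom a b h).1
    refine Finset.card_lt_card (Finset.ssubset_iff_of_subset ?_ |>.2 ⟨a, ?_, ?_⟩)
    · intro x hx
      simp only [Finset.mem_filter] at hx ⊢
      exact ⟨hx.1, htr _ _ _ hx.2 h⟩
    · simp [ha, h]
    · simp [hirr a ha]
  refine ⟨fun a => ((Finset.range n).filter (lt · a)).card, fun a ha b hb => ⟨fun h => ?_, key a b⟩⟩
  by_contra hab
  by_cases e : a = b
  · subst e
    exact lt_irrefl _ h
  · exact (key b a ((htot a b ha hb e).resolve_left hab)).asymm h

theorem foldPos_succ (c : ℕ → ℝ) (m : ℕ) : foldPos c m (c (m + 1)) = foldCrease c (m + 1) := by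
  simp only [foldCrease, foldPos, foldOffset, pow_succ]
  ring

theorem foldCrease_succ_sub (c : ℕ → ℝ) (m : ℕ) :
    foldCrease c (m + 1) - foldCrease c m = (-1) ^ m * (c (m + 1) - c m) := by
  rw [← foldPos_succ]
  simp only [foldCrease, foldPos]
  ring

/-- Flat-foldability in terms of a height function on the folded path. -/
theorem isFlatFoldable_iff {n : ℕ} {c : ℕ → ℝ} {μ : ℕ → MV} :
    IsFlatFoldable n c μ ↔ ∃ (β : Type) (_ : LinearOrder β) (r : ℕ → β),
      PathNoncrossing n (foldCrease c) r ∧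
      ∀ m, m + 1 < n → (r m < r (m + 1) ↔
        ((μ (m + 1) = MV.V ∧ Even m) ∨ (μ (m + 1) = MV.M ∧ Odd m))) := by
  constructor
  · rintro ⟨lt, hirr, htr, htot, hdom, hμ, hlay, hpair⟩
    obtain ⟨r, hr⟩ := exists_height hirr htr htot hdom
    have hbtw : ∀ a < n, ∀ b < n, ∀ x < n, (StrictBtw (r a) (r b) (r x) ↔ Between lt a b x) := by
      intro a ha b hb x hx
      simp only [StrictBtw, Between, hr a ha x hx, hr x hx b hb, hr b hb x hx, hr x hx a ha]
    refine ⟨ℕ, inferInstance, r, ⟨?_, ?_, ?_⟩, ?_⟩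
    · intro x hx y hy e
      by_contra hxy
      rcases htot x y hx hy hxy with h | h
      · exact ((hr x hx y hy).2 h).ne e
      · exact ((hr y hy x hx).2 h).ne' e
    · intro m hm x hx h1 h2
      rw [hbtw m (by omega) (m + 1) hm x hx]
      refine hlay (m + 1) (by omega) (by omega) x hx ?_
      rw [foldPos_succ]
      exact ⟨h1, h2⟩
    · intro m hm m' hm' e
      rw [hbtw m (by omega) (m + 1) hm m' (by omega), hbtw m (by omega) (m + 1) hm (m' + 1) hm']
      by_cases hmm : m = m'
      · subst hmm
        have i0 := hirr m (by omega)
        have i1 := hirr (m + 1) hm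
        simp [Between, i0, i1]
      · exact hpair (m + 1) (m' + 1) (by omega) (by omega) (by omega) (by omega) (by omega) e
    · intro m hm
      rw [hr m (by omega) (m + 1) hm]
      exact hμ (m + 1) (by omega) (by omega)
  · rintro ⟨β, _, r, ⟨hinj, hlay, hpair⟩, hμ⟩
    refine ⟨fun a b => a < n ∧ b < n ∧ r a < r b, ?_, ?_, ?_, ?_, ?_, ?_, ?_⟩
    · exact fun j _ h => lt_irrefl _ h.2.2
    · exact fun a b e h h' => ⟨h.1, h'.2.1, h.2.2.trans h'.2.2⟩
    · intro a b ha hb hab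
      rcases lt_or_gt_of_ne (fun e => hab (hinj a ha b hb e)) with h | h
      · exact .inl ⟨ha, hb, h⟩
      · exact .inr ⟨hb, ha, h⟩
    · exact fun a b h => ⟨h.1, h.2.1⟩
    · intro i hi1 hi2
      obtain ⟨m, rfl⟩ := Nat.exists_eq_add_of_le' hi1
      have hm : m + 1 < n := by omega
      have hm0 : m < n := by omega
      simpa [hm, hm0] using hμ m hm
    · intro i hi1 hi2 j hj h
      obtain ⟨m, rfl⟩ := Nat.exists_eq_add_of_le' hi1
      rw [foldPos_succ] at h
      intro hb
      refine hlay m (by omega) j hj h.1 h.2 ?_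
      simp only [Between, Nat.add_sub_cancel] at hb
      exact hb.imp (fun h => ⟨h.1.2.2, h.2.2.2⟩) (fun h => ⟨h.1.2.2, h.2.2.2⟩)
    · intro i j hi1 hi2 hj1 hj2 _ e
      obtain ⟨m, rfl⟩ := Nat.exists_eq_add_of_le' hi1
      obtain ⟨m', rfl⟩ := Nat.exists_eq_add_of_le' hj1
      have hm : m + 1 < n := by omega
      have hm0 : m < n := by omega
      have hm' : m' + 1 < n := by omega
      have hm0' : m' < n := by omega
      simpa [Between, StrictBtw, hm, hm0, hm', hm0'] using hpair m hm m' hm' e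

/-- Exchanging the labels of two adjacent creases with opposite labels preserves flat-foldability
when the interval between them is at most as long as both of its neighbours. -/
theorem IsFlatFoldable.swap {n : ℕ} {c : ℕ → ℝ} {μ : ℕ → MV} (hC : IsCreasePattern n c)
    (hF : IsFlatFoldable n c μ) {u : ℕ} (hu : u + 2 < n) (hμ : μ (u + 1) ≠ μ (u + 2))
    (hl : c (u + 2) - c (u + 1) ≤ c (u + 1) - c u)
    (hl' : c (u + 2) - c (u + 1) ≤ c (u + 3) - c (u + 2)) :
    IsFlatFoldable n c (μ ∘ Equiv.swap (u + 1) (u + 2)) := by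
  rw [isFlatFoldable_iff] at hF ⊢
  obtain ⟨α, _, r, hr, hrμ⟩ := hF
  have hpos : ∀ m < n, 0 < c (m + 1) - c m := fun m hm => sub_pos.2 (hC.2 m (m + 1) (by omega) hm)
  have habs : ∀ m < n, |foldCrease c (m + 1) - foldCrease c m| = c (m + 1) - c m := by
    intro m hm
    rw [foldCrease_succ_sub, abs_mul, abs_pow, abs_neg, abs_one, one_pow, one_mul,
      abs_of_pos (hpos m hm)]
  have hne : ∀ m < n, foldCrease c m ≠ foldCrease c (m + 1) := by
    intro m hm e
    have := habs m hm
    rw [e, sub_self, abs_zero] at this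
    exact (hpos m hm).ne this
  have halt : ∀ m, m + 1 < n → (foldCrease c m < foldCrease c (m + 1) ↔
      foldCrease c (m + 2) < foldCrease c (m + 1)) := by
    intro m hm
    have h0 := foldCrease_succ_sub c m
    have h1 := foldCrease_succ_sub c (m + 1)
    have p0 := hpos m (by omega)
    have p1 := hpos (m + 1) hm
    rcases neg_one_pow_eq_or ℝ m with e | e <;> simp only [pow_succ, e] at h0 h1 <;>
      constructor <;> intro h <;> linarith
  have hz : r u < r (u + 1) ↔ r (u + 1) < r (u + 2) := by
    rw [hrμ u (by omega), hrμ (u + 1) hu]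
    cases h1 : μ (u + 1) <;> cases h2 : μ (u + 2) <;> simp_all [Nat.even_add_one, Nat.odd_add_one]
  obtain ⟨β, i, r', h, h1, h2, h3⟩ := exists_pathNoncrossing_reverse_zigzag hne halt hr hu hz
    (by rw [habs (u + 1) (by omega), habs u (by omega)]; exact hl)
    (by rw [habs (u + 1) (by omega), habs (u + 2) (by omega)]; exact hl')
  refine ⟨β, i, r', h, fun m hm => ?_⟩
  by_cases hm0 : m = u
  · subst hm0
    rw [h2, hrμ m hm]
    simp only [Function.comp_apply, Equiv.swap_apply_left]
    clear hz h1 h2 h3 hrμ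
    cases h1 : μ (m + 1) <;> cases h2 : μ (m + 2) <;> simp_all
  by_cases hm1 : m = u + 1
  · subst hm1
    rw [h3, hrμ (u + 1) hm]
    simp only [Function.comp_apply, Equiv.swap_apply_right]
    clear hz h1 h2 h3 hrμ
    cases h1 : μ (u + 1) <;> cases h2 : μ (u + 2) <;> simp_all
  · rw [h1 m hm hm0 hm1, hrμ m hm, Function.comp_apply,
      Equiv.swap_apply_of_ne_of_ne (by omega) (by omega)]

/-- Every forcing set of a flat-foldable MV pattern contains at least one crease of any
adjacent pair `(c j, c (j+1))` of opposite μ-value within a crimpable sequence. -/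
theorem forcing_set_hits_crimp_pair (n : ℕ) (c : ℕ → ℝ) (μ : ℕ → MV)
    (hC : IsCreasePattern n c) (hF : IsFlatFoldable n c μ)
    (i k : ℕ) (d : ℝ) (hα : IsCrimpable n c i k d)
    (j : ℕ) (hj1 : i ≤ j) (hj2 : j + 1 ≤ i + k) (hμ : μ j ≠ μ (j + 1))
    (F : Set ℕ) (hforce : IsForcingSet n c μ F) :
    j ∈ F ∨ j + 1 ∈ F := by
  obtain ⟨hi, -, hik, hgap, hfst, hlast⟩ := hα
  obtain ⟨u, rfl⟩ := Nat.exists_eq_add_of_le' (hi.trans hj1)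
  have hmid : c (u + 2) - c (u + 1) = d := hgap (u + 1) hj1 hj2
  have hl : d ≤ c (u + 1) - c u := by
    rcases hj1.eq_or_lt with h | h
    · subst h
      exact hfst.le
    · exact (hgap u (by omega) (by omega)).ge
  have hl' : d ≤ c (u + 3) - c (u + 2) := by
    rcases hj2.eq_or_lt with h | h
    · rw [← h] at hlast
      exact hlast.le
    · exact (hgap (u + 2) (by omega) h).ge
  by_contra! hnot
  have hagree : ∀ x ∈ F, (μ ∘ Equiv.swap (u + 1) (u + 2)) x = μ x := fun x hx => by
    rw [Function.comp_apply, Equiv.swap_apply_of_ne_of_ne] <;> rintro rfl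
    · exact hnot.1 hx
    · exact hnot.2 hx
  have hswap := hF.swap hC (by omega) hμ (hmid.trans_le hl) (hmid.trans_le hl')
  have := hforce.2 _ hswap hagree (u + 1) (by omega) (by omega)
  rw [Function.comp_apply, Equiv.swap_apply_left] at this
  exact hμ this.symm
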